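/- arXiv:1701.01628 — 10 statements merged into one kernel-verified Lean document; each statement's English description precedes it below -/
import Mathlib

section
/- Let W_{a,b} be a joint channel in successive form with binary equiprobable inputs, and let φ_a be any randomized decoder for the a-channel. Then any maximum-likelihood decoder φ_b for the b-channel marginal W_b minimizes the joint error probability over b-channel decoders: for every randomized decoder φ'_b, P(E_a ∪ E_b) evaluated at (φ_a, φ_b) is at most P(E_a ∪ E_b) evaluated at (φ_a, φ'_b). -/
open Finset

/-- `W y u` is the probability that the channel outputs `y` given input `u`. -/
def IsChannel {Y U : Type*} [Fintype Y] (W : Y → U → ℝ) : Prop :=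
  (∀ y u, 0 ≤ W y u) ∧ ∀ u, ∑ y, W y u = 1

/-- A randomized decoder: `φ y u` is the probability of declaring `u` upon observing `y`. -/
def IsDecoder {Y : Type*} (φ : Y → Bool → ℝ) : Prop :=
  (∀ y u, 0 ≤ φ y u) ∧ ∀ y, ∑ u, φ y u = 1

/-- A joint channel with two binary inputs and outputs in `Ya × Yb`. -/
def IsJointChannel {Ya Yb : Type*} [Fintype Ya] [Fintype Yb]
    (W : Ya → Yb → Bool → Bool → ℝ) : Prop :=
  (∀ ya yb ua ub, 0 ≤ W ya yb ua ub) ∧ ∀ ua ub, ∑ ya, ∑ yb, W ya yb ua ub = 1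

/-- a-channel marginal of a joint channel (inputs equiprobable). -/
noncomputable def margA {Ya Yb : Type*} [Fintype Ya] [Fintype Yb]
    (W : Ya → Yb → Bool → Bool → ℝ) (ya : Ya) (ua : Bool) : ℝ :=
  (1 / 2) * ∑ ub, ∑ yb, W ya yb ua ub

/-- b-channel marginal of a joint channel (inputs equiprobable). -/
noncomputable def margB {Ya Yb : Type*} [Fintype Ya] [Fintype Yb]
    (W : Ya → Yb → Bool → Bool → ℝ) (yb : Yb) (ub : Bool) : ℝ :=
  (1 / 2) * ∑ ua, ∑ ya, W ya yb ua ub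

/-- `P(E_a ∪ E_b)`: the probability that at least one of the two decoders errs. -/
noncomputable def PerrUnion {Ya Yb : Type*} [Fintype Ya] [Fintype Yb]
    (W : Ya → Yb → Bool → Bool → ℝ)
    (φa : Ya → Bool → ℝ) (φb : Yb → Bool → ℝ) : ℝ :=
  1 - (1 / 4) * ∑ ua, ∑ ub, ∑ ya, ∑ yb, W ya yb ua ub * φa ya ua * φb yb ub

/-- Successive form: the b-output is `(y_a, u_a, y_r)` with probability one. -/
def SuccessiveForm {Ya Yr : Type*} [Fintype Ya] [Fintype Yr] [DecidableEq Ya]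
    (W : Ya → Ya × Bool × Yr → Bool → Bool → ℝ) : Prop :=
  ∀ ya ya' ua' yr ua ub,
    W ya (ya', ua', yr) ua ub =
      if ya' = ya ∧ ua' = ua then 2 * margB W (ya, ua, yr) ub else 0

/-- A maximum-likelihood decoder for the binary-input channel `V`. -/
def IsMLDecoder {Y : Type*} (V : Y → Bool → ℝ) (φ : Y → Bool → ℝ) : Prop :=
  ∀ y u, 0 < φ y u → V y u = max (V y false) (V y true)

/-- `W` is stochastically degraded from `Q`. -/
def Degraded {Y Z U : Type*} [Fintype Y] [Fintype Z]
    (W : Y → U → ℝ) (Q : Z → U → ℝ) : Prop :=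
  ∃ P : Z → Y → ℝ,
    (∀ z y, 0 ≤ P z y) ∧ (∀ z, ∑ y, P z y = 1) ∧
    ∀ y u, W y u = ∑ z, P z y * Q z u

/-- `Q` is properly upgraded from `W` (both joint channels in successive form). -/
def ProperUpgrade {Ya Yr Za Zr : Type*}
    [Fintype Ya] [Fintype Yr] [Fintype Za] [Fintype Zr]
    (Q : Za → Za × Bool × Zr → Bool → Bool → ℝ)
    (W : Ya → Ya × Bool × Yr → Bool → Bool → ℝ) : Prop :=
  ∃ (Pa : Za → Ya → ℝ) (Pb : Za → Bool → Zr → Ya → Yr → ℝ),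
    (∀ za ya, 0 ≤ Pa za ya) ∧ (∀ za, ∑ ya, Pa za ya = 1) ∧
    (∀ za ua zr ya yr, 0 ≤ Pb za ua zr ya yr) ∧
    (∀ za ua zr ya, ∑ yr, Pb za ua zr ya yr = 1) ∧
    ∀ ya ua yr ub,
      margB W (ya, ua, yr) ub =
        ∑ za, ∑ zr, Pa za ya * Pb za ua zr ya yr * margB Q (za, ua, zr) ub

/-- The minimum over decoder pairs of `P(E_a ∪ E_b)`. -/
noncomputable def PeIMJP {Ya Yb : Type*} [Fintype Ya] [Fintype Yb]
    (W : Ya → Yb → Bool → Bool → ℝ) : ℝ :=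
  sInf {p : ℝ | ∃ φa φb, IsDecoder φa ∧ IsDecoder φb ∧ p = PerrUnion W φa φb}

/-- Error probability of an ML decoder for a binary-input channel with equiprobable inputs. -/
noncomputable def PeML {Y : Type*} [Fintype Y] (V : Y → Bool → ℝ) : ℝ :=
  1 - (1 / 2) * ∑ y, max (V y false) (V y true)

/-- The `D`-value of an output of a binary-input channel. -/
noncomputable def dval {Y : Type*} (V : Y → Bool → ℝ) (y : Y) : ℝ :=
  (V y false - V y true) / (V y false + V y true)

/-- D-value representation: the third component of each positive-probability b-output
is its b-channel D-value (`v` gives the real value of a rest symbol). -/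
def DvalRepJoint {Ya R : Type*} [Fintype Ya] [Fintype R]
    (W : Ya → Ya × Bool × R → Bool → Bool → ℝ) (v : R → ℝ) : Prop :=
  ∀ ya ua r,
    0 < margB W (ya, ua, r) false + margB W (ya, ua, r) true →
    v r = dval (margB W) (ya, ua, r)

/-- A symmetrized joint channel (successive form, D-value representation). -/
def SymmetrizedJoint {Ya R : Type*} [Fintype Ya] [Fintype R]
    (W : Ya → Ya × Bool × R → Bool → Bool → ℝ)
    (v : R → ℝ) (bar : Ya → Ya) (neg : R → R) : Prop :=
  Function.Involutive bar ∧ Function.Involutive neg ∧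
  (∀ r, v (neg r) = -v r) ∧
  (∀ ya ua, margA W ya ua = margA W (bar ya) (!ua)) ∧
  (∀ ya ua r ub,
    margB W (ya, ua, r) ub = margB W (bar ya, !ua, r) ub ∧
    margB W (ya, ua, r) ub = margB W (ya, ua, neg r) (!ub) ∧
    margB W (ya, ua, r) ub = margB W (bar ya, !ua, neg r) (!ub))

/-- A decoupling decomposition `W_b = (1/2)·W_a·W_2` of a symmetrized joint channel. -/
def DecouplingDecomp {Ya R : Type*} [Fintype Ya] [Fintype R]
    (W : Ya → Ya × Bool × R → Bool → Bool → ℝ)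
    (W2 : R → Bool → Ya → Bool → ℝ) : Prop :=
  (∀ r ub ya ua, 0 ≤ W2 r ub ya ua) ∧
  (∀ ya ua ub, ∑ r, W2 r ub ya ua = 1) ∧
  ∀ ya ua r ub, margB W (ya, ua, r) ub = (1 / 2) * margA W ya ua * W2 r ub ya ua

/-- At each output, an ML decoder is correct with weight at least that of any other decoder. -/
lemma IsMLDecoder.sum_mul_le {Y : Type*} {V φ φ' : Y → Bool → ℝ} (hφ : IsDecoder φ)
    (hML : IsMLDecoder V φ) (hφ' : IsDecoder φ') (y : Y) :
    ∑ u, V y u * φ' y u ≤ ∑ u, V y u * φ y u := by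
  have hle (u : Bool) : V y u ≤ max (V y false) (V y true) := by
    cases u
    · exact le_max_left _ _
    · exact le_max_right _ _
  have heq (u : Bool) : V y u * φ y u = max (V y false) (V y true) * φ y u := by
    rcases (hφ.1 y u).eq_or_lt with h | h
    · simp [← h]
    · rw [← hML y u h]
  calc ∑ u, V y u * φ' y u ≤ ∑ u, max (V y false) (V y true) * φ' y u :=
        Finset.sum_le_sum fun u _ => mul_le_mul_of_nonneg_right (hle u) (hφ'.1 y u)
    _ = ∑ u, V y u * φ y u := by
        rw [← Finset.mul_sum, hφ'.2 y, ← hφ.2 y, Finset.mul_sum]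
        exact Finset.sum_congr rfl fun u _ => (heq u).symm

/-- For a joint channel in successive form, with any a-channel decoder `φa`
held fixed, an ML decoder for the b-channel marginal minimizes `P(E_a ∪ E_b)` over
b-channel decoders. -/
theorem stmt0 {Ya Yr : Type*} [Fintype Ya] [Fintype Yr] [DecidableEq Ya]
    (W : Ya → Ya × Bool × Yr → Bool → Bool → ℝ)
    (hW : IsJointChannel W) (hsucc : SuccessiveForm W)
    (φa : Ya → Bool → ℝ) (hφa : IsDecoder φa)
    (φb : Ya × Bool × Yr → Bool → ℝ) (hφb : IsDecoder φb)
    (hML : IsMLDecoder (margB W) φb)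
    (φb' : Ya × Bool × Yr → Bool → ℝ) (hφb' : IsDecoder φb') :
    PerrUnion W φa φb ≤ PerrUnion W φa φb' := by
  unfold PerrUnion
  gcongr 1 - 1 / 4 * ?_
  refine Finset.sum_le_sum fun ua _ => ?_
  rw [Finset.sum_comm, Finset.sum_comm (s := (univ : Finset Bool))]
  refine Finset.sum_le_sum fun ya _ => ?_
  rw [Finset.sum_comm, Finset.sum_comm (s := (univ : Finset Bool))]
  refine Finset.sum_le_sum fun yb _ => ?_
  obtain ⟨ya', ua', yr⟩ := yb
  by_cases h : ya' = ya ∧ ua' = ua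
  · obtain ⟨rfl, rfl⟩ := h
    simp only [hsucc _ _ _ _ _ _, and_self, if_true]
    have key := mul_le_mul_of_nonneg_left (hML.sum_mul_le hφb hφb' (ya', ua', yr))
      (mul_nonneg zero_le_two (hφa.1 ya' ua'))
    rw [Finset.mul_sum, Finset.mul_sum] at key
    convert key using 2 <;> ring
  · simp [hsucc ya ya' ua' yr ua, h]
end

section
/- Let W_{a,b} be a joint channel in successive form with binary equiprobable inputs. Let φ_b be a maximum-likelihood decoder for the b-channel marginal W_b, and let φ_a be any randomized decoder satisfying φ_a(y_a,u_a) > 0 only when T(y_a|u_a) = max_{u'∈{0,1}} T(y_a|u'), where T(y_a|u_a) = Σ_{y_r∈Y_r} max_{u_b∈{0,1}} W_b((y_a,u_a,y_r)|u_b). Then the pair (φ_a,φ_b) attains the minimum of P(E_a ∪ E_b) over all pairs of randomized decoders, i.e., it achieves P_e^IMJP(W_{a,b}). -/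
open Finset

namespace IsDecoder

variable {Y : Type*} {φ : Y → Bool → ℝ}

theorem sum_mul_le_max (hφ : IsDecoder φ) (V : Y → Bool → ℝ) (y : Y) :
    ∑ u, V y u * φ y u ≤ max (V y false) (V y true) := by
  calc ∑ u, V y u * φ y u ≤ ∑ u, max (V y false) (V y true) * φ y u := by
        refine sum_le_sum fun u _ => mul_le_mul_of_nonneg_right ?_ (hφ.1 y u)
        cases u <;> simp
    _ = max (V y false) (V y true) := by rw [← mul_sum, hφ.2 y, mul_one]

theorem sum_mul_eq_max (hφ : IsDecoder φ) {V : Y → Bool → ℝ} (hML : IsMLDecoder V φ) (y : Y) :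
    ∑ u, V y u * φ y u = max (V y false) (V y true) := by
  calc ∑ u, V y u * φ y u = ∑ u, max (V y false) (V y true) * φ y u := by
        refine sum_congr rfl fun u _ => ?_
        rcases (hφ.1 y u).eq_or_lt with h | h
        · simp [← h]
        · rw [hML y u h]
    _ = max (V y false) (V y true) := by rw [← mul_sum, hφ.2 y, mul_one]

end IsDecoder

theorem SuccessiveForm.perrUnion_eq {Ya Yr : Type*} [Fintype Ya] [Fintype Yr] [DecidableEq Ya]
    {W : Ya → Ya × Bool × Yr → Bool → Bool → ℝ} (hsucc : SuccessiveForm W)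
    (φa : Ya → Bool → ℝ) (φb : Ya × Bool × Yr → Bool → ℝ) :
    PerrUnion W φa φb = 1 - (1 / 2) * ∑ ya, ∑ ua,
      (∑ yr, ∑ ub, margB W (ya, ua, yr) ub * φb (ya, ua, yr) ub) * φa ya ua := by
  have inner (ya : Ya) (ua ub : Bool) :
      ∑ yb, W ya yb ua ub * φa ya ua * φb yb ub =
        2 * ∑ yr, margB W (ya, ua, yr) ub * φb (ya, ua, yr) ub * φa ya ua := by
    simp_rw [Fintype.sum_prod_type]
    rw [Fintype.sum_eq_single ya fun ya' h => ?_, Fintype.sum_eq_single ua fun ua' h => ?_,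
      mul_sum]
    · refine sum_congr rfl fun yr _ => ?_
      rw [hsucc, if_pos ⟨rfl, rfl⟩]
      ring
    · exact sum_eq_zero fun yr _ => by rw [hsucc, if_neg fun h' => h h'.2]; ring
    · exact sum_eq_zero fun ua' _ => sum_eq_zero fun yr _ => by
        rw [hsucc, if_neg fun h' => h h'.1]; ring
  have total : ∑ ua, ∑ ub, ∑ ya, ∑ yb, W ya yb ua ub * φa ya ua * φb yb ub =
      2 * ∑ ya, ∑ ua,
        (∑ yr, ∑ ub, margB W (ya, ua, yr) ub * φb (ya, ua, yr) ub) * φa ya ua := by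
    simp_rw [inner, ← mul_sum, sum_mul]
    congr 1
    rw [sum_comm (s := (univ : Finset Ya))]
    refine sum_congr rfl fun ua _ => ?_
    rw [sum_comm]
    exact sum_congr rfl fun ya _ => sum_comm
  rw [PerrUnion, total]
  ring

/-- For a joint channel in successive form, the pair consisting of an ML
decoder for the b-channel marginal and an a-channel decoder maximizing
`T(y_a|u_a) = Σ_{y_r} max_{u_b} W_b((y_a,u_a,y_r)|u_b)` attains the minimum of
`P(E_a ∪ E_b)` over all pairs of randomized decoders (the IMJP decoder). -/
theorem stmt2 {Ya Yr : Type*} [Fintype Ya] [Fintype Yr] [DecidableEq Ya]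
    (W : Ya → Ya × Bool × Yr → Bool → Bool → ℝ)
    (hW : IsJointChannel W) (hsucc : SuccessiveForm W)
    (φb : Ya × Bool × Yr → Bool → ℝ) (hφb : IsDecoder φb)
    (hML : IsMLDecoder (margB W) φb)
    (T : Ya → Bool → ℝ)
    (hT : ∀ ya ua,
      T ya ua = ∑ yr, max (margB W (ya, ua, yr) false) (margB W (ya, ua, yr) true))
    (φa : Ya → Bool → ℝ) (hφa : IsDecoder φa)
    (hmax : ∀ ya ua, 0 < φa ya ua → T ya ua = max (T ya false) (T ya true)) :
    ∀ φa' φb', IsDecoder φa' → IsDecoder φb' →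
      PerrUnion W φa φb ≤ PerrUnion W φa' φb' := by
  intro φa' φb' hφa' hφb'
  rw [hsucc.perrUnion_eq, hsucc.perrUnion_eq]
  gcongr 1 - (1 / 2) * ∑ ya, ?_ with ya
  calc ∑ ua, (∑ yr, ∑ ub, margB W (ya, ua, yr) ub * φb' (ya, ua, yr) ub) * φa' ya ua
      ≤ ∑ ua, T ya ua * φa' ya ua := by
        refine sum_le_sum fun ua _ => mul_le_mul_of_nonneg_right ?_ (hφa'.1 ya ua)
        rw [hT]
        exact sum_le_sum fun yr _ => hφb'.sum_mul_le_max (margB W) (ya, ua, yr)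
    _ ≤ max (T ya false) (T ya true) := hφa'.sum_mul_le_max T ya
    _ = ∑ ua, T ya ua * φa ya ua := (hφa.sum_mul_eq_max hmax ya).symm
    _ = ∑ ua, (∑ yr, ∑ ub, margB W (ya, ua, yr) ub * φb (ya, ua, yr) ub) * φa ya ua := by
        simp_rw [hT, hφb.sum_mul_eq_max hML]
end

section
/- If Q_{a,b} is properly upgraded from W_{a,b} (both joint channels in successive form), then the a-channel marginal Q_a is upgraded from W_a (i.e., W_a ≼ Q_a) and the b-channel marginal Q_b is upgraded from W_b (i.e., W_b ≼ Q_b). -/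
open Finset

/-- In successive form, the a-marginal is obtained from the b-marginal by summing over
the b-input and the rest symbol. -/
theorem SuccessiveForm.margA_eq {Ya Yr : Type*} [Fintype Ya] [Fintype Yr] [DecidableEq Ya]
    {W : Ya → Ya × Bool × Yr → Bool → Bool → ℝ} (hW : SuccessiveForm W) (ya : Ya) (ua : Bool) :
    margA W ya ua = ∑ ub, ∑ yr, margB W (ya, ua, yr) ub := by
  have h (ub : Bool) : ∑ yb, W ya yb ua ub = 2 * ∑ yr, margB W (ya, ua, yr) ub := by
    rw [Fintype.sum_prod_type, Finset.sum_eq_single ya, Fintype.sum_prod_type,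
      Finset.sum_eq_single ua, Finset.mul_sum]
    · simp [hW ya]
    · intro u _ hu
      simp [hW ya, hu]
    · simp
    · intro y _ hy
      simp [hW ya, hy]
    · simp
  simp only [margA, h, ← Finset.mul_sum]
  ring

/-- A proper upgrade of joint channels in successive form upgrades the a-marginal. -/
theorem ProperUpgrade.degraded_margA {Ya Yr Za Zr : Type*}
    [Fintype Ya] [Fintype Yr] [Fintype Za] [Fintype Zr] [DecidableEq Ya] [DecidableEq Za]
    {W : Ya → Ya × Bool × Yr → Bool → Bool → ℝ} {Q : Za → Za × Bool × Zr → Bool → Bool → ℝ}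
    (hup : ProperUpgrade Q W) (hW : SuccessiveForm W) (hQ : SuccessiveForm Q) :
    Degraded (margA W) (margA Q) := by
  obtain ⟨Pa, Pb, hPa, hPa1, -, hPb1, hWQ⟩ := hup
  refine ⟨Pa, hPa, hPa1, fun ya ua => ?_⟩
  have h (ub : Bool) : ∑ yr, margB W (ya, ua, yr) ub =
      ∑ za, Pa za ya * ∑ zr, margB Q (za, ua, zr) ub := by
    simp only [hWQ]
    rw [Finset.sum_comm]
    refine Finset.sum_congr rfl fun za _ => ?_
    rw [Finset.sum_comm, Finset.mul_sum]
    refine Finset.sum_congr rfl fun zr _ => ?_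
    rw [← Finset.sum_mul, ← Finset.mul_sum, hPb1, mul_one]
  simp only [hW.margA_eq, hQ.margA_eq, h, Finset.mul_sum]
  exact Finset.sum_comm

/-- A proper upgrade upgrades the b-marginal: the degrading channel keeps `u_a` and
applies the two component channels to the other coordinates. -/
theorem ProperUpgrade.degraded_margB {Ya Yr Za Zr : Type*}
    [Fintype Ya] [Fintype Yr] [Fintype Za] [Fintype Zr]
    {W : Ya → Ya × Bool × Yr → Bool → Bool → ℝ} {Q : Za → Za × Bool × Zr → Bool → Bool → ℝ}
    (hup : ProperUpgrade Q W) : Degraded (margB W) (margB Q) := by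
  obtain ⟨Pa, Pb, hPa, hPa1, hPb, hPb1, hWQ⟩ := hup
  refine ⟨fun z y => if y.2.1 = z.2.1 then
    Pa z.1 y.1 * Pb z.1 z.2.1 z.2.2 y.1 y.2.2 else 0, ?_, ?_, ?_⟩
  · intro z y
    dsimp only
    split_ifs
    exacts [mul_nonneg (hPa _ _) (hPb _ _ _ _ _), le_rfl]
  · rintro ⟨za, ua, zr⟩
    simp only [Fintype.sum_prod_type]
    rw [← hPa1 za]
    refine Finset.sum_congr rfl fun ya _ => ?_
    rw [Finset.sum_eq_single ua]
    · simp [← Finset.mul_sum, hPb1]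
    · intro u _ hu
      simp [hu]
    · simp
  · rintro ⟨ya, ua, yr⟩ ub
    rw [hWQ, Fintype.sum_prod_type]
    refine Finset.sum_congr rfl fun za _ => ?_
    rw [Fintype.sum_prod_type, Finset.sum_eq_single ua]
    · simp
    · intro u _ hu
      simp [hu.symm]
    · simp

/-- If `Q_{a,b}` is properly upgraded from `W_{a,b}` (both joint channels in
successive form), then both marginals of `W_{a,b}` are degraded from the corresponding
marginals of `Q_{a,b}`. -/
theorem stmt3 {Ya Yr Za Zr : Type*}
    [Fintype Ya] [Fintype Yr] [Fintype Za] [Fintype Zr]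
    [DecidableEq Ya] [DecidableEq Za]
    (W : Ya → Ya × Bool × Yr → Bool → Bool → ℝ)
    (Q : Za → Za × Bool × Zr → Bool → Bool → ℝ)
    (hWj : IsJointChannel W) (hWs : SuccessiveForm W)
    (hQj : IsJointChannel Q) (hQs : SuccessiveForm Q)
    (hup : ProperUpgrade Q W) :
    Degraded (margA W) (margA Q) ∧ Degraded (margB W) (margB Q) := by
  exact ⟨hup.degraded_margA hWs hQs, hup.degraded_margB⟩
end

section
/- If Q_{a,b} is properly upgraded from W_{a,b} (both joint channels in successive form), then P_e^IMJP(Q_{a,b}) ≤ P_e^IMJP(W_{a,b}); that is, the minimum over decoder pairs of the probability that at least one decoder errs for Q_{a,b} is at most the corresponding minimum for W_{a,b}. -/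
open Finset

theorem IsDecoder.le_one {Y : Type*} {φ : Y → Bool → ℝ} (hφ : IsDecoder φ) (y : Y) (u : Bool) :
    φ y u ≤ 1 :=
  hφ.2 y ▸ single_le_sum (f := φ y) (fun v _ => hφ.1 y v) (mem_univ u)

theorem isDecoder_uniform {Y : Type*} : IsDecoder (fun (_ : Y) (_ : Bool) => (1 / 2 : ℝ)) :=
  ⟨fun _ _ => by norm_num, fun _ => by norm_num⟩

theorem PerrUnion_nonneg {Ya Yb : Type*} [Fintype Ya] [Fintype Yb]
    {W : Ya → Yb → Bool → Bool → ℝ} (hW : IsJointChannel W)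
    {φa : Ya → Bool → ℝ} {φb : Yb → Bool → ℝ} (ha : IsDecoder φa) (hb : IsDecoder φb) :
    0 ≤ PerrUnion W φa φb := by
  have h (ua ub : Bool) : ∑ ya, ∑ yb, W ya yb ua ub * φa ya ua * φb yb ub ≤ 1 := by
    rw [← hW.2 ua ub]
    refine sum_le_sum fun ya _ => sum_le_sum fun yb _ => ?_
    rw [mul_assoc]
    exact mul_le_of_le_one_right (hW.1 _ _ _ _)
      (mul_le_one₀ (ha.le_one _ _) (hb.1 _ _) (hb.le_one _ _))
  simp only [PerrUnion, Fintype.sum_bool]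
  linarith [h true true, h true false, h false true, h false false]

theorem PeIMJP_le {Ya Yb : Type*} [Fintype Ya] [Fintype Yb]
    {W : Ya → Yb → Bool → Bool → ℝ} (hW : IsJointChannel W)
    {φa : Ya → Bool → ℝ} {φb : Yb → Bool → ℝ} (ha : IsDecoder φa) (hb : IsDecoder φb) :
    PeIMJP W ≤ PerrUnion W φa φb := by
  refine csInf_le ⟨0, ?_⟩ ⟨φa, φb, ha, hb, rfl⟩
  rintro _ ⟨χa, χb, hχa, hχb, rfl⟩
  exact PerrUnion_nonneg hW hχa hχb

theorem le_PeIMJP {Ya Yb : Type*} [Fintype Ya] [Fintype Yb]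
    {W : Ya → Yb → Bool → Bool → ℝ} {c : ℝ}
    (h : ∀ φa φb, IsDecoder φa → IsDecoder φb → c ≤ PerrUnion W φa φb) :
    c ≤ PeIMJP W := by
  refine le_csInf ⟨_, _, _, isDecoder_uniform, isDecoder_uniform, rfl⟩ ?_
  rintro _ ⟨φa, φb, ha, hb, rfl⟩
  exact h φa φb ha hb

theorem SuccessiveForm.PerrUnion_eq {Ya Yr : Type*} [Fintype Ya] [Fintype Yr] [DecidableEq Ya]
    {W : Ya → Ya × Bool × Yr → Bool → Bool → ℝ} (hW : SuccessiveForm W)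
    (φa : Ya → Bool → ℝ) (φb : Ya × Bool × Yr → Bool → ℝ) :
    PerrUnion W φa φb = 1 - (1 / 4) * ∑ ua, ∑ ub, ∑ ya, ∑ yr,
      2 * margB W (ya, ua, yr) ub * φa ya ua * φb (ya, ua, yr) ub := by
  unfold PerrUnion
  congr 2
  refine sum_congr rfl fun ua _ => sum_congr rfl fun ub _ => sum_congr rfl fun ya _ => ?_
  have h := hW ya
  simp only [Fintype.sum_prod_type, h]
  rw [sum_eq_single ya (fun y _ hy => by simp [hy]) (by simp),
    sum_eq_single ua (fun u _ hu => by simp [hu]) (by simp)]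
  simp

/-- The a-decoder that passes the output through `P` before applying `φ`. -/
noncomputable def pullDecoder {Y Z : Type*} [Fintype Y] (P : Z → Y → ℝ) (φ : Y → Bool → ℝ)
    (z : Z) (u : Bool) : ℝ :=
  ∑ y, P z y * φ y u

theorem isDecoder_pullDecoder {Y Z : Type*} [Fintype Y] {P : Z → Y → ℝ} {φ : Y → Bool → ℝ}
    (hP : ∀ z y, 0 ≤ P z y) (hP1 : ∀ z, ∑ y, P z y = 1) (hφ : IsDecoder φ) :
    IsDecoder (pullDecoder P φ) := by
  refine ⟨fun z u => sum_nonneg fun y _ => mul_nonneg (hP z y) (hφ.1 y u), fun z => ?_⟩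
  simp only [pullDecoder]
  rw [sum_comm]
  simp only [← mul_sum, hφ.2, mul_one, hP1]

/-- The joint weight of a correct a-decision `ua` and a b-decision `ub`, when the a-output and the
rest symbol are simulated from `(za, ua, zr)`. -/
noncomputable def pullWeight {Ya Yr Za Zr : Type*} [Fintype Ya] [Fintype Yr]
    (Pa : Za → Ya → ℝ) (Pb : Za → Bool → Zr → Ya → Yr → ℝ)
    (φa : Ya → Bool → ℝ) (φb : Ya × Bool × Yr → Bool → ℝ)
    (za : Za) (ua : Bool) (zr : Zr) (ub : Bool) : ℝ :=
  ∑ ya, Pa za ya * φa ya ua * ∑ yr, Pb za ua zr ya yr * φb (ya, ua, yr) ub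

theorem sum_pullWeight {Ya Yr Za Zr : Type*} [Fintype Ya] [Fintype Yr]
    (Pa : Za → Ya → ℝ) {Pb : Za → Bool → Zr → Ya → Yr → ℝ}
    (φa : Ya → Bool → ℝ) {φb : Ya × Bool × Yr → Bool → ℝ}
    (hPb : ∀ za ua zr ya, ∑ yr, Pb za ua zr ya yr = 1) (hφb : IsDecoder φb)
    (za : Za) (ua : Bool) (zr : Zr) :
    ∑ ub, pullWeight Pa Pb φa φb za ua zr ub = pullDecoder Pa φa za ua := by
  simp only [pullWeight, pullDecoder]
  rw [sum_comm]
  refine sum_congr rfl fun ya _ => ?_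
  rw [← mul_sum, sum_comm]
  simp only [← mul_sum, hφb.2, mul_one, hPb]

theorem sum_comm_pairs {A B C D : Type*} [Fintype A] [Fintype B] [Fintype C] [Fintype D]
    (f : A → B → C → D → ℝ) :
    ∑ a, ∑ b, ∑ c, ∑ d, f a b c d = ∑ c, ∑ d, ∑ a, ∑ b, f a b c d := by
  simpa only [Fintype.sum_prod_type] using
    sum_comm (s := univ) (t := univ) (f := fun (p : A × B) (q : C × D) => f p.1 p.2 q.1 q.2)

/-- A family of nonnegative weights can be normalized to a decoder. -/
theorem exists_isDecoder_of_nonneg {Y : Type*} {w : Y → Bool → ℝ} (hw : ∀ y u, 0 ≤ w y u) :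
    ∃ φ, IsDecoder φ ∧ ∀ y u, (∑ v, w y v) * φ y u = w y u := by
  refine ⟨fun y u => if ∑ v, w y v = 0 then 1 / 2 else w y u / ∑ v, w y v,
    ⟨fun y u => ?_, fun y => ?_⟩, fun y u => ?_⟩
  · beta_reduce
    split_ifs
    · norm_num
    · exact div_nonneg (hw y u) (sum_nonneg fun v _ => hw y v)
  · beta_reduce
    split_ifs with h
    · norm_num
    · rw [← sum_div, div_self h]
  · beta_reduce
    split_ifs with h
    · rw [h, zero_mul, (sum_eq_zero_iff_of_nonneg fun v _ => hw y v).1 h u (mem_univ u)]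
    · exact mul_div_cancel₀ _ h

/-- Proper upgrading can only decrease the minimal joint probability of
error over decoder pairs: if `Q_{a,b} ≽p W_{a,b}` then `P_e^IMJP(Q_{a,b}) ≤ P_e^IMJP(W_{a,b})`. -/
theorem stmt4 {Ya Yr Za Zr : Type*}
    [Fintype Ya] [Fintype Yr] [Fintype Za] [Fintype Zr]
    [DecidableEq Ya] [DecidableEq Za]
    (W : Ya → Ya × Bool × Yr → Bool → Bool → ℝ)
    (Q : Za → Za × Bool × Zr → Bool → Bool → ℝ)
    (hWj : IsJointChannel W) (hWs : SuccessiveForm W)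
    (hQj : IsJointChannel Q) (hQs : SuccessiveForm Q)
    (hup : ProperUpgrade Q W) :
    PeIMJP Q ≤ PeIMJP W := by
  obtain ⟨Pa, Pb, hPa, hPa1, hPb, hPb1, hmarg⟩ := hup
  refine le_PeIMJP fun φa φb hφa hφb => ?_
  obtain ⟨ψb, hψb, hψb_mul⟩ := exists_isDecoder_of_nonneg
    (w := fun (z : Za × Bool × Zr) ub => pullWeight Pa Pb φa φb z.1 z.2.1 z.2.2 ub)
    fun z ub => sum_nonneg fun ya _ => mul_nonneg (mul_nonneg (hPa _ _) (hφa.1 _ _))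
      (sum_nonneg fun yr _ => mul_nonneg (hPb _ _ _ _ _) (hφb.1 _ _))
  simp only [sum_pullWeight Pa φa hPb1 hφb, Prod.forall] at hψb_mul
  refine (PeIMJP_le hQj (isDecoder_pullDecoder hPa hPa1 hφa) hψb).trans_eq ?_
  rw [hQs.PerrUnion_eq, hWs.PerrUnion_eq]
  congr 2
  refine sum_congr rfl fun ua _ => sum_congr rfl fun ub _ => ?_
  simp only [mul_assoc, hψb_mul, hmarg, pullWeight, mul_sum, sum_mul]
  rw [sum_comm_pairs]
  refine sum_congr rfl fun ya _ => sum_congr rfl fun yr _ => sum_congr rfl fun za _ =>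
    sum_congr rfl fun zr _ => ?_
  ring
end

section
/- Let W_{a,b} be a joint channel in successive form with b-outputs (y_a,u_a,y_r). Define W'_{a,b} to be the successive-form joint channel whose b-outputs are triples (y_a,u_a,d) with d ∈ ℝ, obtained by merging, for each fixed (y_a,u_a), all y_r for which the b-channel D-value of (y_a,u_a,y_r) equals d: W'_b(y_a,u_a,d|u_b) = Σ_{y_r : d-value of (y_a,u_a,y_r) is d} W_b((y_a,u_a,y_r)|u_b). Then W'_{a,b} is in D-value representation, and the two channels are equivalent via proper degrading channels: W'_{a,b} ≽p W_{a,b} and W_{a,b} ≽p W'_{a,b}. -/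
open Finset

/-- Nonnegative weights are recovered from their sum and normalised difference. -/
theorem eq_add_mul_of_dval {Y : Type*} {V : Y → Bool → ℝ} (hV : ∀ y u, 0 ≤ V y u)
    {dv : Y → ℝ} (hdv : ∀ y, 0 < V y false + V y true → dv y = dval V y) (y : Y) (u : Bool) :
    V y u = (V y false + V y true) * ((1 + (if u then -dv y else dv y)) / 2) := by
  have h0 := hV y false
  have h1 := hV y true
  rcases (add_nonneg h0 h1).eq_or_lt' with h | h
  · have : V y u = 0 := by cases u <;> linarith
    rw [h, this, zero_mul]
  · have hd := hdv y h
    rw [dval, eq_div_iff h.ne'] at hd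
    cases u <;> simp only [Bool.false_eq_true, if_true, if_false] <;> linarith

theorem margB_nonneg {Ya Yb : Type*} [Fintype Ya] [Fintype Yb]
    {W : Ya → Yb → Bool → Bool → ℝ} (hW : IsJointChannel W) (yb : Yb) (ub : Bool) :
    0 ≤ margB W yb ub :=
  mul_nonneg (by norm_num) (sum_nonneg fun _ _ => sum_nonneg fun _ _ => hW.1 _ _ _ _)

/-- A joint channel supported on consistent b-outputs has the expected b-channel marginal. -/
theorem margB_eq_of_forall_eq_ite {Ya R : Type*} [Fintype Ya] [Fintype R] [DecidableEq Ya]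
    {W : Ya → Ya × Bool × R → Bool → Bool → ℝ} {f : Ya → Bool → R → Bool → ℝ}
    (h : ∀ ya ya' ua' r ua ub,
      W ya (ya', ua', r) ua ub = if ya' = ya ∧ ua' = ua then 2 * f ya ua r ub else 0)
    (ya : Ya) (ua : Bool) (r : R) (ub : Bool) :
    margB W (ya, ua, r) ub = f ya ua r ub := by
  simp only [margB, h, ite_and]
  simp

/-- Merging, for each fixed `(y_a,u_a)`, all rest symbols `y_r` with the same
b-channel D-value yields an equivalent joint channel `W'` in D-value representation:
`W' ≽p W` and `W ≽p W'`. -/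
theorem stmt6 {Ya Yr : Type*} [Fintype Ya] [Fintype Yr] [DecidableEq Ya]
    (W : Ya → Ya × Bool × Yr → Bool → Bool → ℝ)
    (hW : IsJointChannel W) (hsucc : SuccessiveForm W)
    (dv : Ya × Bool × Yr → ℝ)
    (hdv : ∀ t, 0 < margB W t false + margB W t true → dv t = dval (margB W) t)
    (W' : Ya → Ya × Bool × {d : ℝ // d ∈ Finset.image dv Finset.univ} → Bool → Bool → ℝ)
    (hW' : ∀ ya ya' ua' (d : {d : ℝ // d ∈ Finset.image dv Finset.univ}) ua ub,
      W' ya (ya', ua', d) ua ub =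
        if ya' = ya ∧ ua' = ua then
          2 * ∑ yr ∈ Finset.univ.filter (fun yr => dv (ya, ua, yr) = (d : ℝ)),
            margB W (ya, ua, yr) ub
        else 0) :
    SuccessiveForm W' ∧ DvalRepJoint W' (fun d => (d : ℝ)) ∧
    ProperUpgrade W' W ∧ ProperUpgrade W W' := by
  set S : Ya → Bool → {d : ℝ // d ∈ Finset.image dv Finset.univ} → Bool → ℝ :=
    fun ya ua d ub => ∑ yr ∈ Finset.univ.filter (fun yr => dv (ya, ua, yr) = (d : ℝ)),
      margB W (ya, ua, yr) ub with hS
  have hm : ∀ ya ua d ub, margB W' (ya, ua, d) ub = S ya ua d ub :=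
    margB_eq_of_forall_eq_ite hW'
  have hnn := margB_nonneg hW
  have hfac := eq_add_mul_of_dval hnn hdv
  set p : Ya × Bool × Yr → ℝ := fun t => margB W t false + margB W t true with hp
  have hpnn : ∀ t, 0 ≤ p t := fun t => add_nonneg (hnn t false) (hnn t true)
  set P : Ya → Bool → {d : ℝ // d ∈ Finset.image dv Finset.univ} → ℝ :=
    fun ya ua d => ∑ yr ∈ Finset.univ.filter (fun yr => dv (ya, ua, yr) = (d : ℝ)),
      p (ya, ua, yr) with hP
  have hSP : ∀ ya ua d ub,
      S ya ua d ub = P ya ua d * ((1 + (if ub then -(d : ℝ) else d)) / 2) := by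
    intro ya ua d ub
    simp only [hS, hP, Finset.sum_mul]
    refine Finset.sum_congr rfl fun yr hyr => ?_
    rw [hfac, (Finset.mem_filter.mp hyr).2]
  have hPnn : ∀ ya ua d, 0 ≤ P ya ua d := fun ya ua d => sum_nonneg fun _ _ => hpnn _
  refine ⟨fun ya ya' ua' d ua ub => ?_, fun ya ua d hpos => ?_, ?_, ?_⟩
  · rw [hW', hm]
  · rw [dval]
    rw [hm, hm, hSP, hSP] at hpos ⊢
    rw [eq_div_iff hpos.ne']
    simp only [Bool.false_eq_true, if_true, if_false]
    ring
  · refine ⟨fun za ya => if za = ya then 1 else 0, fun za ua d _ yr =>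
      if P za ua d = 0 then 1 / (Fintype.card Yr : ℝ)
      else if dv (za, ua, yr) = d then p (za, ua, yr) / P za ua d else 0,
      fun za ya => by positivity, fun za => by simp, fun za ua d ya yr => ?_,
      fun za ua d ya => ?_, fun ya ua yr ub => ?_⟩
    · have := div_nonneg (hpnn (za, ua, yr)) (hPnn za ua d)
      dsimp only
      split_ifs <;> positivity
    · dsimp only
      split_ifs with h
      · obtain ⟨t, -, -⟩ := Finset.mem_image.mp d.2
        have : Nonempty Yr := ⟨t.2.2⟩
        have : (Fintype.card Yr : ℝ) ≠ 0 := Nat.cast_ne_zero.mpr Fintype.card_ne_zero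
        simp [this]
      · rw [← Finset.sum_filter, ← Finset.sum_div]
        exact div_self h
    · rw [Finset.sum_eq_single ya (fun za _ hza => by simp [hza]) (by simp)]
      have hmem : dv (ya, ua, yr) ∈ Finset.image dv Finset.univ :=
        Finset.mem_image_of_mem _ (Finset.mem_univ _)
      rw [Finset.sum_eq_single ⟨dv (ya, ua, yr), hmem⟩ ?_ (by simp)]
      · rw [hm, hSP, hfac]
        simp only [if_true]
        by_cases h0 : P ya ua ⟨dv (ya, ua, yr), hmem⟩ = 0
        · have hp0 : p (ya, ua, yr) = 0 :=
            (Finset.sum_eq_zero_iff_of_nonneg fun _ _ => hpnn _).mp h0 yr (by simp)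
          have hp0' : margB W (ya, ua, yr) false + margB W (ya, ua, yr) true = 0 := hp0
          simp [h0, hp0']
        · simp only [h0, if_false]
          field_simp
          exact mul_comm _ _
      · intro d _ hd
        have hne : dv (ya, ua, yr) ≠ d := fun h => hd (Subtype.ext h.symm)
        rw [hm, hSP]
        by_cases h0 : P ya ua d = 0
        · simp [h0]
        · simp [h0, hne]
  · refine ⟨fun za ya => if za = ya then 1 else 0, fun za ua zr _ d =>
      if dv (za, ua, zr) = d then 1 else 0,
      fun za ya => by positivity, fun za => by simp, fun za ua d ya yr => by positivity,
      fun za ua zr ya => ?_, fun ya ua d ub => ?_⟩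
    · rw [Finset.sum_eq_single
        ⟨dv (za, ua, zr), Finset.mem_image_of_mem _ (Finset.mem_univ _)⟩ ?_ (by simp)]
      · simp
      · exact fun d _ hd => if_neg fun h => hd (Subtype.ext h.symm)
    · rw [hm, Finset.sum_eq_single ya (fun za _ hza => by simp [hza]) (by simp)]
      simp only [hS, Finset.sum_filter, if_true, one_mul, ite_mul, zero_mul]
end

section
/- Let W and Q be BMS channels with Q ≽ W (Q upgraded from W). Then the joint channel Q_{−,+} is properly upgraded from W_{−,+}: Q_{−,+} ≽p W_{−,+}. -/
open Finset

/-- A BMS channel: a binary-input channel with an involutive output conjugation. -/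
def IsBMS {Y : Type*} [Fintype Y] (W : Y → Bool → ℝ) : Prop :=
  IsChannel W ∧ ∃ c : Y → Y, Function.Involutive c ∧ ∀ y, W y false = W (c y) true

/-- The joint channel `W_{−,+}` of the `−` and `+` polar transforms of a binary-input
channel `W`, in successive form: the a-output is `(y_1,y_2)` and the b-output is
`((y_1,y_2), u_1, ())`. -/
noncomputable def minusPlus {Y : Type*} [Fintype Y] [DecidableEq Y]
    (W : Y → Bool → ℝ) :
    Y × Y → (Y × Y) × Bool × Unit → Bool → Bool → ℝ :=
  fun ya yb u1 u2 =>
    if yb.1 = ya ∧ yb.2.1 = u1 then W ya.1 (xor u1 u2) * W ya.2 u2 else 0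

/-- The b-channel marginal of `minusPlus W` is the plus transform `W^+`. -/
lemma margB_minusPlus {Y : Type*} [Fintype Y] [DecidableEq Y] (W : Y → Bool → ℝ)
    (y : Y × Y) (u₁ : Bool) (r : Unit) (u₂ : Bool) :
    margB (minusPlus W) (y, u₁, r) u₂ = (1 / 2) * (W y.1 (xor u₁ u₂) * W y.2 u₂) := by
  unfold margB minusPlus
  simp only [ite_and, Finset.sum_ite_eq, Finset.mem_univ, if_true]

/-- If `Q ≽ W` for BMS channels `W` and `Q`, then
`Q_{−,+} ≽p W_{−,+}`. -/
theorem stmt7 {Y Z : Type*} [Fintype Y] [Fintype Z] [DecidableEq Y] [DecidableEq Z]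
    (W : Y → Bool → ℝ) (Q : Z → Bool → ℝ)
    (hW : IsBMS W) (hQ : IsBMS Q)
    (hdeg : Degraded W Q) :
    ProperUpgrade (minusPlus Q) (minusPlus W) := by
  obtain ⟨P, hP0, hP1, hP⟩ := hdeg
  refine ⟨fun z y => P z.1 y.1 * P z.2 y.2, fun _ _ _ _ _ => 1,
    fun z y => mul_nonneg (hP0 _ _) (hP0 _ _), fun z => ?_, by simp, by simp, ?_⟩
  · simp only [Fintype.sum_prod_type, ← Finset.mul_sum, hP1, mul_one]
  · intro y u₁ _ u₂
    simp only [margB_minusPlus, hP, Fintype.sum_prod_type, Finset.univ_unique,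
      Finset.sum_singleton]
    rw [Finset.sum_mul_sum, Finset.mul_sum]
    refine Finset.sum_congr rfl fun _ _ => ?_
    rw [Finset.mul_sum]
    exact Finset.sum_congr rfl fun _ _ => by ring
end

section
/- Let W_{a,b} and Q_{a,b} be joint channels in successive form with Q_{a,b} ≽p W_{a,b}. Then for every pair (α,β) ∈ {−,+}², the jointly polarized channel Q_{a^α,b^β} is properly upgraded from the jointly polarized channel W_{a^α,b^β}: Q_{a^α,b^β} ≽p W_{a^α,b^β}. -/
open Finset

/-- Joint polarization `(α,β) = (−,−)` of a successive-form joint channel.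
The a-output is `(y_a, η_a)`; the rest of the b-output is `(ν_a, d_b, δ_b)`. -/
noncomputable def polMM {Ya Yr : Type*} [Fintype Ya] [Fintype Yr]
    [DecidableEq Ya] [DecidableEq Yr]
    (W : Ya → Ya × Bool × Yr → Bool → Bool → ℝ) :
    Ya × Ya → (Ya × Ya) × Bool × (Bool × Yr × Yr) → Bool → Bool → ℝ :=
  fun p q ua ub =>
    if q.1 = p ∧ q.2.1 = ua then
      ∑ nb, margB W (p.1, xor ua q.2.2.1, q.2.2.2.1) (xor ub nb) *
            margB W (p.2, q.2.2.1, q.2.2.2.2) nb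
    else 0

/-- Joint polarization `(α,β) = (−,+)`.
The a-output is `(y_a, η_a)`; the rest of the b-output is `(ν_a, u_b, d_b, δ_b)`. -/
noncomputable def polMP {Ya Yr : Type*} [Fintype Ya] [Fintype Yr]
    [DecidableEq Ya] [DecidableEq Yr]
    (W : Ya → Ya × Bool × Yr → Bool → Bool → ℝ) :
    Ya × Ya → (Ya × Ya) × Bool × (Bool × Bool × Yr × Yr) → Bool → Bool → ℝ :=
  fun p q ua nb =>
    if q.1 = p ∧ q.2.1 = ua then
      margB W (p.1, xor ua q.2.2.1, q.2.2.2.2.1) (xor q.2.2.2.1 nb) *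
      margB W (p.2, q.2.2.1, q.2.2.2.2.2) nb
    else 0

/-- Joint polarization `(α,β) = (+,−)`.
The a-output is `(y_a, η_a, u_a)`; the rest of the b-output is `(d_b, δ_b)`. -/
noncomputable def polPM {Ya Yr : Type*} [Fintype Ya] [Fintype Yr]
    [DecidableEq Ya] [DecidableEq Yr]
    (W : Ya → Ya × Bool × Yr → Bool → Bool → ℝ) :
    Ya × Ya × Bool → (Ya × Ya × Bool) × Bool × (Yr × Yr) → Bool → Bool → ℝ :=
  fun p q na ub =>
    if q.1 = p ∧ q.2.1 = na then
      ∑ nb, margB W (p.1, xor p.2.2 na, q.2.2.1) (xor ub nb) *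
            margB W (p.2.1, na, q.2.2.2) nb
    else 0

/-- Joint polarization `(α,β) = (+,+)`.
The a-output is `(y_a, η_a, u_a)`; the rest of the b-output is `(u_b, d_b, δ_b)`. -/
noncomputable def polPP {Ya Yr : Type*} [Fintype Ya] [Fintype Yr]
    [DecidableEq Ya] [DecidableEq Yr]
    (W : Ya → Ya × Bool × Yr → Bool → Bool → ℝ) :
    Ya × Ya × Bool → (Ya × Ya × Bool) × Bool × (Bool × Yr × Yr) → Bool → Bool → ℝ :=
  fun p q na nb =>
    if q.1 = p ∧ q.2.1 = na then
      margB W (p.1, xor p.2.2 na, q.2.2.2.1) (xor q.2.2.1 nb) *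
      margB W (p.2.1, na, q.2.2.2.2) nb
    else 0

section JointPolarization

variable {Ya Yr Za Zr : Type*} [Fintype Ya] [Fintype Yr] [Fintype Za] [Fintype Zr]

theorem margB_polMM [DecidableEq Ya] [DecidableEq Yr]
    (W : Ya → Ya × Bool × Yr → Bool → Bool → ℝ)
    (y η : Ya) (ua ν : Bool) (d δ : Yr) (ub : Bool) :
    margB (polMM W) ((y, η), ua, ν, d, δ) ub =
      (1 / 2) * ∑ nb, margB W (y, xor ua ν, d) (xor ub nb) * margB W (η, ν, δ) nb := by
  conv_lhs => unfold margB
  simp [polMM, ite_and]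

theorem margB_polMP [DecidableEq Ya] [DecidableEq Yr]
    (W : Ya → Ya × Bool × Yr → Bool → Bool → ℝ)
    (y η : Ya) (ua ν ub : Bool) (d δ : Yr) (nb : Bool) :
    margB (polMP W) ((y, η), ua, ν, ub, d, δ) nb =
      (1 / 2) * (margB W (y, xor ua ν, d) (xor ub nb) * margB W (η, ν, δ) nb) := by
  conv_lhs => unfold margB
  simp [polMP, ite_and]

theorem margB_polPM [DecidableEq Ya] [DecidableEq Yr]
    (W : Ya → Ya × Bool × Yr → Bool → Bool → ℝ)
    (y η : Ya) (ua na : Bool) (d δ : Yr) (ub : Bool) :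
    margB (polPM W) ((y, η, ua), na, d, δ) ub =
      (1 / 2) * ∑ nb, margB W (y, xor ua na, d) (xor ub nb) * margB W (η, na, δ) nb := by
  conv_lhs => unfold margB
  simp [polPM, ite_and]

theorem margB_polPP [DecidableEq Ya] [DecidableEq Yr]
    (W : Ya → Ya × Bool × Yr → Bool → Bool → ℝ)
    (y η : Ya) (ua na ub : Bool) (d δ : Yr) (nb : Bool) :
    margB (polPP W) ((y, η, ua), na, ub, d, δ) nb =
      (1 / 2) * (margB W (y, xor ua na, d) (xor ub nb) * margB W (η, na, δ) nb) := by
  conv_lhs => unfold margB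
  simp [polPP, ite_and]

/-- The product of two `b`-channel marginals is obtained by degrading both factors. -/
theorem margB_mul_margB
    {W : Ya → Ya × Bool × Yr → Bool → Bool → ℝ} {Q : Za → Za × Bool × Zr → Bool → Bool → ℝ}
    {Pa : Za → Ya → ℝ} {Pb : Za → Bool → Zr → Ya → Yr → ℝ}
    (h : ∀ ya ua yr ub, margB W (ya, ua, yr) ub =
      ∑ za, ∑ zr, Pa za ya * Pb za ua zr ya yr * margB Q (za, ua, zr) ub)
    (y η : Ya) (u v : Bool) (d δ : Yr) (b c : Bool) :
    margB W (y, u, d) b * margB W (η, v, δ) c =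
      ∑ z, ∑ ζ, ∑ r, ∑ ρ, (Pa z y * Pa ζ η) * (Pb z u r y d * Pb ζ v ρ η δ) *
        (margB Q (z, u, r) b * margB Q (ζ, v, ρ) c) := by
  rw [h, h, Finset.sum_mul_sum]
  refine Finset.sum_congr rfl fun z _ => Finset.sum_congr rfl fun ζ _ => ?_
  rw [Finset.sum_mul_sum]
  exact Finset.sum_congr rfl fun r _ => Finset.sum_congr rfl fun ρ _ => by ring

/-- The product of two families summing to `1` sums to `1`. -/
theorem sum_sum_mul_eq_one {f g : Ya → ℝ} (hf : ∑ y, f y = 1) (hg : ∑ y, g y = 1) :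
    ∑ y, ∑ η, f y * g η = 1 := by
  rw [← Finset.sum_mul_sum, hf, hg, one_mul]

theorem ProperUpgrade.polMM [DecidableEq Ya] [DecidableEq Yr] [DecidableEq Za] [DecidableEq Zr]
    {W : Ya → Ya × Bool × Yr → Bool → Bool → ℝ} {Q : Za → Za × Bool × Zr → Bool → Bool → ℝ}
    (h : ProperUpgrade Q W) : ProperUpgrade (polMM Q) (polMM W) := by
  obtain ⟨Pa, Pb, hPa, hPa1, hPb, hPb1, hW⟩ := h
  refine ⟨fun p q => Pa p.1 q.1 * Pa p.2 q.2,
    fun p u r q s => if r.1 = s.1 then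
      Pb p.1 (xor u r.1) r.2.1 q.1 s.2.1 * Pb p.2 r.1 r.2.2 q.2 s.2.2 else 0,
    ?_, ?_, ?_, ?_, ?_⟩
  · intro p q
    have := mul_nonneg (hPa p.1 q.1) (hPa p.2 q.2)
    grind
  · intro p
    simp [Fintype.sum_prod_type, sum_sum_mul_eq_one, hPa1]
  · intro p u r q s
    have := mul_nonneg (hPb p.1 (xor u r.1) r.2.1 q.1 s.2.1) (hPb p.2 r.1 r.2.2 q.2 s.2.2)
    grind
  · intro p u r q
    simp [Fintype.sum_prod_type, sum_sum_mul_eq_one, hPb1]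
  · rintro ⟨y, η⟩ u ⟨ν, d, δ⟩ c
    simp only [margB_polMM, Fintype.sum_prod_type, margB_mul_margB hW, Fintype.sum_bool, mul_add,
      Finset.mul_sum, ← Finset.sum_add_distrib]
    refine Finset.sum_congr rfl fun z _ => Finset.sum_congr rfl fun ζ _ => ?_
    cases ν <;>
      simp only [reduceIte, reduceCtorEq, zero_mul, mul_zero, add_zero, zero_add] <;>
      exact Finset.sum_congr rfl fun r _ => Finset.sum_congr rfl fun ρ _ => by ring

theorem ProperUpgrade.polMP [DecidableEq Ya] [DecidableEq Yr] [DecidableEq Za] [DecidableEq Zr]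
    {W : Ya → Ya × Bool × Yr → Bool → Bool → ℝ} {Q : Za → Za × Bool × Zr → Bool → Bool → ℝ}
    (h : ProperUpgrade Q W) : ProperUpgrade (polMP Q) (polMP W) := by
  obtain ⟨Pa, Pb, hPa, hPa1, hPb, hPb1, hW⟩ := h
  refine ⟨fun p q => Pa p.1 q.1 * Pa p.2 q.2,
    fun p u r q s => if r.1 = s.1 ∧ r.2.1 = s.2.1 then
      Pb p.1 (xor u r.1) r.2.2.1 q.1 s.2.2.1 * Pb p.2 r.1 r.2.2.2 q.2 s.2.2.2 else 0,
    ?_, ?_, ?_, ?_, ?_⟩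
  · intro p q
    have := mul_nonneg (hPa p.1 q.1) (hPa p.2 q.2)
    grind
  · intro p
    simp [Fintype.sum_prod_type, sum_sum_mul_eq_one, hPa1]
  · intro p u r q s
    have := mul_nonneg (hPb p.1 (xor u r.1) r.2.2.1 q.1 s.2.2.1) (hPb p.2 r.1 r.2.2.2 q.2 s.2.2.2)
    grind
  · intro p u r q
    simp [Fintype.sum_prod_type, ite_and, sum_sum_mul_eq_one, hPb1]
  · rintro ⟨y, η⟩ u ⟨ν, b, d, δ⟩ c
    simp only [margB_polMP, ite_and, Fintype.sum_prod_type, margB_mul_margB hW,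
      Fintype.sum_bool, Finset.mul_sum, ← Finset.sum_add_distrib]
    refine Finset.sum_congr rfl fun z _ => Finset.sum_congr rfl fun ζ _ => ?_
    cases ν <;> cases b <;>
      simp only [reduceIte, reduceCtorEq, zero_mul, mul_zero, add_zero, zero_add] <;>
      exact Finset.sum_congr rfl fun r _ => Finset.sum_congr rfl fun ρ _ => by ring

theorem ProperUpgrade.polPM [DecidableEq Ya] [DecidableEq Yr] [DecidableEq Za] [DecidableEq Zr]
    {W : Ya → Ya × Bool × Yr → Bool → Bool → ℝ} {Q : Za → Za × Bool × Zr → Bool → Bool → ℝ}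
    (h : ProperUpgrade Q W) : ProperUpgrade (polPM Q) (polPM W) := by
  obtain ⟨Pa, Pb, hPa, hPa1, hPb, hPb1, hW⟩ := h
  refine ⟨fun p q => if p.2.2 = q.2.2 then Pa p.1 q.1 * Pa p.2.1 q.2.1 else 0,
    fun p u r q s => Pb p.1 (xor p.2.2 u) r.1 q.1 s.1 * Pb p.2.1 u r.2 q.2.1 s.2,
    ?_, ?_, ?_, ?_, ?_⟩
  · intro p q
    have := mul_nonneg (hPa p.1 q.1) (hPa p.2.1 q.2.1)
    grind
  · intro p
    simp [Fintype.sum_prod_type, sum_sum_mul_eq_one, hPa1]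
  · intro p u r q s
    have := mul_nonneg (hPb p.1 (xor p.2.2 u) r.1 q.1 s.1) (hPb p.2.1 u r.2 q.2.1 s.2)
    grind
  · intro p u r q
    simp [Fintype.sum_prod_type, sum_sum_mul_eq_one, hPb1]
  · rintro ⟨y, η, u⟩ v ⟨d, δ⟩ c
    simp only [margB_polPM, Fintype.sum_prod_type, margB_mul_margB hW, Fintype.sum_bool, mul_add,
      Finset.mul_sum, ← Finset.sum_add_distrib]
    refine Finset.sum_congr rfl fun z _ => Finset.sum_congr rfl fun ζ _ => ?_
    cases u <;>
      simp only [reduceIte, reduceCtorEq, zero_mul, add_zero, zero_add] <;>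
      exact Finset.sum_congr rfl fun r _ => Finset.sum_congr rfl fun ρ _ => by ring

theorem ProperUpgrade.polPP [DecidableEq Ya] [DecidableEq Yr] [DecidableEq Za] [DecidableEq Zr]
    {W : Ya → Ya × Bool × Yr → Bool → Bool → ℝ} {Q : Za → Za × Bool × Zr → Bool → Bool → ℝ}
    (h : ProperUpgrade Q W) : ProperUpgrade (polPP Q) (polPP W) := by
  obtain ⟨Pa, Pb, hPa, hPa1, hPb, hPb1, hW⟩ := h
  refine ⟨fun p q => if p.2.2 = q.2.2 then Pa p.1 q.1 * Pa p.2.1 q.2.1 else 0,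
    fun p u r q s => if r.1 = s.1 then
      Pb p.1 (xor p.2.2 u) r.2.1 q.1 s.2.1 * Pb p.2.1 u r.2.2 q.2.1 s.2.2 else 0,
    ?_, ?_, ?_, ?_, ?_⟩
  · intro p q
    have := mul_nonneg (hPa p.1 q.1) (hPa p.2.1 q.2.1)
    grind
  · intro p
    simp [Fintype.sum_prod_type, sum_sum_mul_eq_one, hPa1]
  · intro p u r q s
    have := mul_nonneg (hPb p.1 (xor p.2.2 u) r.2.1 q.1 s.2.1) (hPb p.2.1 u r.2.2 q.2.1 s.2.2)
    grind
  · intro p u r q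
    simp [Fintype.sum_prod_type, sum_sum_mul_eq_one, hPb1]
  · rintro ⟨y, η, u⟩ v ⟨b, d, δ⟩ c
    simp only [margB_polPP, Fintype.sum_prod_type, margB_mul_margB hW, Fintype.sum_bool,
      Finset.mul_sum, ← Finset.sum_add_distrib]
    refine Finset.sum_congr rfl fun z _ => Finset.sum_congr rfl fun ζ _ => ?_
    cases u <;> cases b <;>
      simp only [reduceIte, reduceCtorEq, zero_mul, mul_zero, add_zero, zero_add] <;>
      exact Finset.sum_congr rfl fun r _ => Finset.sum_congr rfl fun ρ _ => by ring

end JointPolarization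

/-- Proper upgrading is preserved by all four joint polarization
transforms. -/
theorem stmt8 {Ya Yr Za Zr : Type*}
    [Fintype Ya] [Fintype Yr] [Fintype Za] [Fintype Zr]
    [DecidableEq Ya] [DecidableEq Yr] [DecidableEq Za] [DecidableEq Zr]
    (W : Ya → Ya × Bool × Yr → Bool → Bool → ℝ)
    (Q : Za → Za × Bool × Zr → Bool → Bool → ℝ)
    (hWj : IsJointChannel W) (hWs : SuccessiveForm W)
    (hQj : IsJointChannel Q) (hQs : SuccessiveForm Q)
    (hup : ProperUpgrade Q W) :
    ProperUpgrade (polMM Q) (polMM W) ∧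
    ProperUpgrade (polMP Q) (polMP W) ∧
    ProperUpgrade (polPM Q) (polPM W) ∧
    ProperUpgrade (polPP Q) (polPP W) :=
  ⟨hup.polMM, hup.polMP, hup.polPM, hup.polPP⟩
end

section
/- Let W_{a,b} be a joint channel in successive form and D-value representation exhibiting double symmetry, and suppose the b-conjugate map y_a ↦ y_a^b is an involution of Y_a. Define the symmetrized joint channel W̃_{a,b}, whose a-outputs are the orbits C of this involution, by W̃_b(C,u_a,d_b|u_b) = Σ_{y_a∈C} W_b(y_a,u_a,d_b|u_b). Then the minimum over decoder pairs of the probability that at least one decoder errs is the same for both channels: P_e^IMJP(W̃_{a,b}) = P_e^IMJP(W_{a,b}). -/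
open Finset

/-- The deterministic decoder declaring an input of maximal score `V y u`. -/
noncomputable def argmaxDecoder {Y : Type*} (V : Y → Bool → ℝ) (y : Y) (u : Bool) : ℝ :=
  if u = decide (V y false < V y true) then 1 else 0

theorem isDecoder_argmaxDecoder {Y : Type*} (V : Y → Bool → ℝ) :
    IsDecoder (argmaxDecoder V) := by
  refine ⟨fun y u => ?_, fun y => ?_⟩
  · unfold argmaxDecoder
    split_ifs <;> norm_num
  · simp [argmaxDecoder]

theorem sum_mul_argmaxDecoder {Y : Type*} (V : Y → Bool → ℝ) (y : Y) :
    ∑ u, V y u * argmaxDecoder V y u = max (V y false) (V y true) := by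
  by_cases h : V y false < V y true
  · simp [argmaxDecoder, h, h.le]
  · simp [argmaxDecoder, h, not_lt.mp h]

theorem IsDecoder.sum_mul_le_max_s11 {Y : Type*} {φ : Y → Bool → ℝ} (hφ : IsDecoder φ)
    (V : Y → Bool → ℝ) (y : Y) :
    ∑ u, V y u * φ y u ≤ max (V y false) (V y true) := by
  have hsum := hφ.2 y
  have h₀ := mul_le_mul_of_nonneg_right (le_max_left (V y false) (V y true)) (hφ.1 y false)
  have h₁ := mul_le_mul_of_nonneg_right (le_max_right (V y false) (V y true)) (hφ.1 y true)
  rw [Fintype.sum_bool] at hsum ⊢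
  calc V y true * φ y true + V y false * φ y false
      ≤ max (V y false) (V y true) * (φ y true + φ y false) := by linarith
    _ = max (V y false) (V y true) := by rw [hsum, mul_one]

/-- Total probability (over the rest symbol) that the b-decoder succeeds when it is given the
a-output `x` and the a-input `u`, under maximum-likelihood decoding. -/
noncomputable def genieScore {X R : Type*} [Fintype R] (M : X × Bool × R → Bool → ℝ)
    (x : X) (u : Bool) : ℝ :=
  ∑ r, max (M (x, u, r) false) (M (x, u, r) true)

section SuccessiveChannel

variable {X R : Type*} [Fintype X] [Fintype R] [DecidableEq X]
  {W : X → X × Bool × R → Bool → Bool → ℝ} {M : X × Bool × R → Bool → ℝ}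

theorem perrUnion_of_successive
    (hW : ∀ x x' u' r u b,
      W x (x', u', r) u b = if x' = x ∧ u' = u then 2 * M (x, u, r) b else 0)
    (φa : X → Bool → ℝ) (φb : X × Bool × R → Bool → ℝ) :
    PerrUnion W φa φb =
      1 - 1 / 2 * ∑ x, ∑ u, (∑ r, ∑ b, M (x, u, r) b * φb (x, u, r) b) * φa x u := by
  have key : ∀ u b x, ∑ yb, W x yb u b * φa x u * φb yb b =
      2 * ∑ r, M (x, u, r) b * φb (x, u, r) b * φa x u := by
    intro u b x
    rw [Fintype.sum_prod_type, Finset.sum_eq_single x, Fintype.sum_prod_type,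
      Finset.sum_eq_single u, Finset.mul_sum]
    · refine Finset.sum_congr rfl fun r _ => ?_
      rw [hW, if_pos ⟨rfl, rfl⟩]
      ring
    · intro u' _ hu'
      exact Finset.sum_eq_zero fun r _ => by simp [hW, hu']
    · simp
    · intro x' _ hx'
      exact Finset.sum_eq_zero fun p _ => by simp [hW, hx']
    · simp
  unfold PerrUnion
  simp only [key, Fintype.sum_bool, ← Finset.mul_sum, ← Finset.sum_mul, Finset.sum_add_distrib,
    add_mul]
  ring

theorem peIMJP_of_successive
    (hW : ∀ x x' u' r u b,
      W x (x', u', r) u b = if x' = x ∧ u' = u then 2 * M (x, u, r) b else 0) :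
    PeIMJP W = 1 - 1 / 2 * ∑ x, max (genieScore M x false) (genieScore M x true) := by
  refine IsLeast.csInf_eq ⟨⟨argmaxDecoder (genieScore M), argmaxDecoder M,
    isDecoder_argmaxDecoder _, isDecoder_argmaxDecoder _, ?_⟩, ?_⟩
  · rw [perrUnion_of_successive hW]
    simp only [sum_mul_argmaxDecoder]
    simp only [← sum_mul_argmaxDecoder (genieScore M)]
    rfl
  · rintro _ ⟨φa, φb, hφa, hφb, rfl⟩
    rw [perrUnion_of_successive hW]
    have hle : ∑ x, ∑ u, (∑ r, ∑ b, M (x, u, r) b * φb (x, u, r) b) * φa x u ≤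
        ∑ x, max (genieScore M x false) (genieScore M x true) := by
      refine Finset.sum_le_sum fun x _ => le_trans (Finset.sum_le_sum fun u _ => ?_)
        (hφa.sum_mul_le_max_s11 (genieScore M) x)
      exact mul_le_mul_of_nonneg_right
        (Finset.sum_le_sum fun r _ => hφb.sum_mul_le_max_s11 M (x, u, r)) (hφa.1 x u)
    linarith

end SuccessiveChannel

theorem max_sum_eq_sum_max {ι : Type*} (s : Finset ι) (f g : ι → ℝ)
    (h : (∀ i ∈ s, f i ≤ g i) ∨ ∀ i ∈ s, g i ≤ f i) :
    max (∑ i ∈ s, f i) (∑ i ∈ s, g i) = ∑ i ∈ s, max (f i) (g i) := by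
  rcases h with h | h
  · rw [max_eq_right (Finset.sum_le_sum h)]
    exact Finset.sum_congr rfl fun i hi => (max_eq_right (h i hi)).symm
  · rw [max_eq_left (Finset.sum_le_sum h)]
    exact Finset.sum_congr rfl fun i hi => (max_eq_left (h i hi)).symm

theorem margB_sub_eq_of_dvalRep {Ya R : Type*} [Fintype Ya] [Fintype R]
    {W : Ya → Ya × Bool × R → Bool → Bool → ℝ} {v : R → ℝ}
    (hW : IsJointChannel W) (hrep : DvalRepJoint W v) (ya : Ya) (ua : Bool) (r : R) :
    margB W (ya, ua, r) false - margB W (ya, ua, r) true =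
      v r * (margB W (ya, ua, r) false + margB W (ya, ua, r) true) := by
  have h₀ := margB_nonneg hW (ya, ua, r) false
  have h₁ := margB_nonneg hW (ya, ua, r) true
  rcases (add_nonneg h₀ h₁).lt_or_eq with h | h
  · rw [hrep ya ua r h, dval, div_mul_cancel₀ _ h.ne']
  · rw [← h]
    linarith

/-- In D-value representation the rest symbol alone determines a maximum-likelihood decision. -/
theorem margB_order_of_dvalRep {Ya R : Type*} [Fintype Ya] [Fintype R]
    {W : Ya → Ya × Bool × R → Bool → Bool → ℝ} {v : R → ℝ}
    (hW : IsJointChannel W) (hrep : DvalRepJoint W v) (ua : Bool) (r : R) :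
    (∀ ya, margB W (ya, ua, r) false ≤ margB W (ya, ua, r) true) ∨
      ∀ ya, margB W (ya, ua, r) true ≤ margB W (ya, ua, r) false := by
  have hs := fun ya => add_nonneg (margB_nonneg hW (ya, ua, r) false)
    (margB_nonneg hW (ya, ua, r) true)
  rcases le_total (v r) 0 with hv | hv
  · left
    intro ya
    linarith [margB_sub_eq_of_dvalRep hW hrep ya ua r, mul_nonpos_of_nonpos_of_nonneg hv (hs ya)]
  · right
    intro ya
    linarith [margB_sub_eq_of_dvalRep hW hrep ya ua r, mul_nonneg hv (hs ya)]

/-- A conjugation flipping the b-input and permuting the rest symbols preserves `genieScore`. -/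
theorem genieScore_conj {X R : Type*} [Fintype R] {M : X × Bool × R → Bool → ℝ}
    {neg : R → R} (hneg : Function.Bijective neg) {x x' : X} {u : Bool}
    (h : ∀ r b, M (x, u, r) b = M (x', u, neg r) (!b)) :
    genieScore M x u = genieScore M x' u := by
  unfold genieScore
  rw [← hneg.sum_comp fun r => max (M (x', u, r) false) (M (x', u, r) true)]
  refine Finset.sum_congr rfl fun r _ => ?_
  rw [h r false, h r true, max_comm]
  rfl

/-- Symmetrization preserves the minimal joint probability of error: if the
b-conjugation `cb` is an involution of the a-output alphabet, and the symmetrized joint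
channel `Wt` is obtained by merging each orbit `{y_a, y_a^b}` into a single a-output, then
`P_e^IMJP(Wt) = P_e^IMJP(W)`. -/
theorem stmt11 {Ya R C : Type*} [Fintype Ya] [Fintype R] [Fintype C]
    [DecidableEq Ya] [DecidableEq C]
    (W : Ya → Ya × Bool × R → Bool → Bool → ℝ) (v : R → ℝ)
    (neg : R → R) (ca cb cab : Ya → Ya)
    (hW : IsJointChannel W) (hsucc : SuccessiveForm W)
    (hrep : DvalRepJoint W v)
    (hneg : Function.Involutive neg) (hnegv : ∀ r, v (neg r) = -v r)
    (hds : ∀ ya ua r ub,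
      margB W (ya, ua, r) ub = margB W (ca ya, !ua, r) ub ∧
      margB W (ya, ua, r) ub = margB W (cb ya, ua, neg r) (!ub) ∧
      margB W (ya, ua, r) ub = margB W (cab ya, !ua, neg r) (!ub))
    (hcb : Function.Involutive cb)
    (π : Ya → C) (hπ : Function.Surjective π)
    (hfib : ∀ ya ya', π ya' = π ya ↔ (ya' = ya ∨ ya' = cb ya))
    (Wt : C → C × Bool × R → Bool → Bool → ℝ)
    (hWt : ∀ c c' ua' r ua ub,
      Wt c (c', ua', r) ua ub =
        if c' = c ∧ ua' = ua then
          2 * ∑ ya ∈ Finset.univ.filter (fun ya => π ya = c),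
            margB W (ya, ua, r) ub
        else 0) :
    PeIMJP Wt = PeIMJP W := by
  rw [peIMJP_of_successive (M := margB W) hsucc,
    peIMJP_of_successive
      (M := fun p b => ∑ ya ∈ Finset.univ.filter (fun ya => π ya = p.1), margB W (ya, p.2) b) hWt]
  have hscore : ∀ c u, genieScore
      (fun (p : C × Bool × R) b =>
        ∑ ya ∈ Finset.univ.filter (fun ya => π ya = p.1), margB W (ya, p.2) b) c u =
      ∑ ya ∈ Finset.univ.filter (fun ya => π ya = c), genieScore (margB W) ya u := by
    intro c u
    unfold genieScore
    rw [Finset.sum_comm]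
    refine Finset.sum_congr rfl fun r _ => max_sum_eq_sum_max _ _ _ ?_
    exact (margB_order_of_dvalRep hW hrep u r).imp (fun h ya _ => h ya) (fun h ya _ => h ya)
  have hconst : ∀ ya ya' u, π ya' = π ya →
      genieScore (margB W) ya' u = genieScore (margB W) ya u := by
    intro ya ya' u h
    rcases (hfib ya ya').mp h with rfl | rfl
    · rfl
    · exact (genieScore_conj hneg.bijective fun r b => (hds ya u r b).2.1).symm
  rw [← Finset.sum_fiberwise Finset.univ π
    fun ya => max (genieScore (margB W) ya false) (genieScore (margB W) ya true)]
  congr 2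
  refine Finset.sum_congr rfl fun c _ => ?_
  rw [hscore, hscore]
  obtain ⟨y, rfl⟩ := hπ c
  refine max_sum_eq_sum_max _ _ _ ?_
  refine (le_total (genieScore (margB W) y false) (genieScore (margB W) y true)).imp ?_ ?_ <;>
  · intro h ya hya
    rw [hconst y ya _ (Finset.mem_filter.mp hya).2, hconst y ya _ (Finset.mem_filter.mp hya).2]
    exact h
end

section
/- Let W_b and Q_b be symmetrized joint channels (successive form, D-value representation) with decoupling decompositions W_b(y_a,u_a,d_b|u_b) = (1/2)·W_a(y_a|u_a)·W_2(d_b|u_b;y_a,u_a) and Q_b(z_a,u_a,z_b|u_b) = (1/2)·Q_a(z_a|u_a)·Q_2(z_b|u_b;z_a,u_a). Suppose (1) Q_a ≽ W_a with degrading channel P_a(y_a|z_a), and (2) for all u_a, y_a, z_a with P_a(y_a|z_a) > 0, the binary-input channel Q_2(·|·;z_a,u_a) is upgraded from W_2(·|·;y_a,u_a). Then Q_b is properly upgraded from W_b: Q_b ≽p W_b. -/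
open Finset

/-- (Upgrading the a-channel.) Let `W` and `Q` be symmetrized joint
channels with decoupling decompositions `W_b = (1/2)·W_a·W_2` and `Q_b = (1/2)·Q_a·Q_2`.
If `Q_a ≽ W_a` with degrading channel `P_a`, and for all `u_a, y_a, z_a` with
`P_a(y_a|z_a) > 0` the channel `Q_2(·|·;z_a,u_a)` is upgraded from `W_2(·|·;y_a,u_a)`,
then `Q ≽p W`. -/
theorem stmt13 {Ya R Za S : Type*}
    [Fintype Ya] [Fintype R] [Fintype Za] [Fintype S]
    [DecidableEq Ya] [DecidableEq Za]
    (W : Ya → Ya × Bool × R → Bool → Bool → ℝ)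
    (vW : R → ℝ) (barW : Ya → Ya) (negW : R → R)
    (Q : Za → Za × Bool × S → Bool → Bool → ℝ)
    (vQ : S → ℝ) (barQ : Za → Za) (negQ : S → S)
    (hWj : IsJointChannel W) (hWs : SuccessiveForm W)
    (hWr : DvalRepJoint W vW) (hWsym : SymmetrizedJoint W vW barW negW)
    (hQj : IsJointChannel Q) (hQs : SuccessiveForm Q)
    (hQr : DvalRepJoint Q vQ) (hQsym : SymmetrizedJoint Q vQ barQ negQ)
    (W2 : R → Bool → Ya → Bool → ℝ) (Q2 : S → Bool → Za → Bool → ℝ)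
    (hW2 : DecouplingDecomp W W2) (hQ2 : DecouplingDecomp Q Q2)
    (Pa : Za → Ya → ℝ)
    (hPa0 : ∀ za ya, 0 ≤ Pa za ya) (hPa1 : ∀ za, ∑ ya, Pa za ya = 1)
    (hPadeg : ∀ ya ua, margA W ya ua = ∑ za, Pa za ya * margA Q za ua)
    (h2 : ∀ ua ya za, 0 < Pa za ya →
      Degraded (fun r ub => W2 r ub ya ua) (fun s ub => Q2 s ub za ua)) :
    ProperUpgrade Q W := by
  have key : ∀ za ua ya, ∃ P : S → R → ℝ, (∀ s r, 0 ≤ P s r) ∧ (∀ s, ∑ r, P s r = 1) ∧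
      ∀ r ub, Pa za ya * W2 r ub ya ua = Pa za ya * ∑ s, P s r * Q2 s ub za ua := by
    intro za ua ya
    rcases (hPa0 za ya).lt_or_eq with hpos | hzero
    · obtain ⟨P, hP0, hP1, hP⟩ := h2 ua ya za hpos
      exact ⟨P, hP0, hP1, fun r ub => congrArg (Pa za ya * ·) (hP r ub)⟩
    · exact ⟨fun _ r => W2 r false ya ua, fun _ r => hW2.1 r false ya ua,
        fun _ => hW2.2.1 ya ua false, fun r ub => by simp [← hzero]⟩
  choose P hP0 hP1 hP using key
  refine ⟨Pa, fun za ua s ya r => P za ua ya s r, hPa0, hPa1,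
    fun za ua s ya r => hP0 za ua ya s r, fun za ua s ya => hP1 za ua ya s, ?_⟩
  intro ya ua r ub
  rw [hW2.2.2, hPadeg, Finset.mul_sum, Finset.sum_mul]
  refine Finset.sum_congr rfl fun za _ => ?_
  calc 1 / 2 * (Pa za ya * margA Q za ua) * W2 r ub ya ua
      = 1 / 2 * margA Q za ua * (Pa za ya * W2 r ub ya ua) := by ring
    _ = 1 / 2 * margA Q za ua * (Pa za ya * ∑ s, P za ua ya s r * Q2 s ub za ua) := by rw [hP]
    _ = ∑ s, Pa za ya * P za ua ya s r * margB Q (za, ua, s) ub := by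
      simp only [hQ2.2.2, Finset.mul_sum]
      exact Finset.sum_congr rfl fun s _ => by ring
end

section
/- Let W_b be a symmetrized joint channel (successive form, D-value representation, with involution y_a ↦ ȳ_a) and let Ŵ_b be its upgrade-couple channel. Then Ŵ_b is symmetrized with the involution y_a^{i,j} ↦ ȳ_a^{j,i}: for all y_a,i,j,u_a,d_b,u_b, Ŵ_b(y_a^{i,j},u_a,d_b|u_b) = Ŵ_b(ȳ_a^{j,i},1−u_a,d_b|u_b) = Ŵ_b(y_a^{i,j},u_a,−d_b|1−u_b) = Ŵ_b(ȳ_a^{j,i},1−u_a,−d_b|1−u_b), and the a-channel marginal satisfies Ŵ_a(y_a^{i,j}|u_a) = Ŵ_a(ȳ_a^{j,i}|1−u_a). -/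
open Finset

/-- The real value of a signed D-value symbol: `(s, i)` stands for `+d_{bi}` if `s = false`
and `−d_{bi}` if `s = true`. -/
noncomputable def vD {B : ℕ} (dB : Fin B → ℝ) : Bool × Fin B → ℝ :=
  fun r => if r.1 then -dB r.2 else dB r.2

/-- Negation (conjugation) of a signed D-value symbol. -/
def negD {B : ℕ} : Bool × Fin B → Bool × Fin B := fun r => (!r.1, r.2)

/-- The splitting factor `S_{i,j}(y_a, u_a, d_b)` of the upgrade-couple transform. -/
noncomputable def Sfac {Ya : Type*} {B : ℕ}
    (W2 : Bool × Fin B → Bool → Ya → Bool → ℝ)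
    (i j : Fin B) (ya : Ya) (ua : Bool) (r : Bool × Fin B) : ℝ :=
  if ua = false then
    (if r.2 = i then ∑ ub, W2 (false, j) ub ya true else 0)
  else
    (if r.2 = j then ∑ ub, W2 (false, i) ub ya false else 0)

/-- `α_{i,j}(y_a) = S_{i,j}(y_a,0,d_{bi}) · S_{i,j}(y_a,1,d_{bj})`. -/
noncomputable def alphaFac {Ya : Type*} {B : ℕ}
    (W2 : Bool × Fin B → Bool → Ya → Bool → ℝ) (i j : Fin B) (ya : Ya) : ℝ :=
  Sfac W2 i j ya false (false, i) * Sfac W2 i j ya true (false, j)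

/-- The upgrade-couple joint channel `Ŵ_{a,b}`, in successive form, with a-outputs
`y_a^{i,j} = (y_a, i, j)` and b-marginal
`Ŵ_b(y_a^{i,j}, u_a, d_b | u_b) = W_b(y_a, u_a, d_b | u_b) · S_{i,j}(y_a, u_a, d_b)`. -/
noncomputable def upgradeCouple {Ya : Type*} [Fintype Ya] [DecidableEq Ya] {B : ℕ}
    (W : Ya → Ya × Bool × (Bool × Fin B) → Bool → Bool → ℝ)
    (W2 : Bool × Fin B → Bool → Ya → Bool → ℝ) :
    Ya × Fin B × Fin B →
      (Ya × Fin B × Fin B) × Bool × (Bool × Fin B) → Bool → Bool → ℝ :=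
  fun p q ua ub =>
    if q.1 = p ∧ q.2.1 = ua then
      2 * (margB W (p.1, ua, q.2.2) ub * Sfac W2 p.2.1 p.2.2 p.1 ua q.2.2)
    else 0

theorem margB_upgradeCouple {Ya : Type*} [Fintype Ya] [DecidableEq Ya] {B : ℕ}
    (W : Ya → Ya × Bool × (Bool × Fin B) → Bool → Bool → ℝ)
    (W2 : Bool × Fin B → Bool → Ya → Bool → ℝ)
    (p : Ya × Fin B × Fin B) (ua : Bool) (r : Bool × Fin B) (ub : Bool) :
    margB (upgradeCouple W W2) (p, ua, r) ub =
      margB W (p.1, ua, r) ub * Sfac W2 p.2.1 p.2.2 p.1 ua r := by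
  have h : ∀ ua', ∑ p', upgradeCouple W W2 p' (p, ua, r) ua' ub =
      if ua = ua' then 2 * (margB W (p.1, ua, r) ub * Sfac W2 p.2.1 p.2.2 p.1 ua r) else 0 := by
    intro ua'
    simp only [upgradeCouple, ite_and, Finset.sum_ite_eq, Finset.mem_univ, if_true]
    split_ifs with h
    · rw [h]
    · rfl
  rw [margB]
  simp only [h, Finset.sum_ite_eq, Finset.mem_univ, if_true]
  ring

theorem margA_upgradeCouple {Ya : Type*} [Fintype Ya] [DecidableEq Ya] {B : ℕ}
    (W : Ya → Ya × Bool × (Bool × Fin B) → Bool → Bool → ℝ)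
    (W2 : Bool × Fin B → Bool → Ya → Bool → ℝ)
    (p : Ya × Fin B × Fin B) (ua : Bool) :
    margA (upgradeCouple W W2) p ua =
      ∑ ub, ∑ r, margB (upgradeCouple W W2) (p, ua, r) ub := by
  simp only [margB_upgradeCouple]
  rw [margA, Finset.mul_sum]
  refine Finset.sum_congr rfl fun ub _ => ?_
  rw [Fintype.sum_prod_type, Finset.sum_eq_single p, Fintype.sum_prod_type,
    Finset.sum_eq_single ua]
  · simp only [upgradeCouple, and_self, if_true]
    rw [← Finset.mul_sum]
    ring
  · intro b _ hb
    simp [upgradeCouple, hb]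
  · simp
  · intro b _ hb
    simp [upgradeCouple, hb]
  · simp

theorem Sfac_bar_swap {Ya : Type*} {B : ℕ} {W2 : Bool × Fin B → Bool → Ya → Bool → ℝ}
    {bar : Ya → Ya} (hW2bar : ∀ r ub ya ua, W2 r ub (bar ya) (!ua) = W2 r ub ya ua)
    (i j : Fin B) (ya : Ya) (ua : Bool) (r : Bool × Fin B) :
    Sfac W2 j i (bar ya) (!ua) r = Sfac W2 i j ya ua r := by
  have h0 := fun r ub => hW2bar r ub ya false
  have h1 := fun r ub => hW2bar r ub ya true
  simp only [Bool.not_false, Bool.not_true] at h0 h1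
  cases ua <;> simp [Sfac, h0, h1]

theorem Sfac_negD {Ya : Type*} {B : ℕ} (W2 : Bool × Fin B → Bool → Ya → Bool → ℝ)
    (i j : Fin B) (ya : Ya) (ua : Bool) (r : Bool × Fin B) :
    Sfac W2 i j ya ua (negD r) = Sfac W2 i j ya ua r := rfl

/-- The upgrade-couple channel of a symmetrized joint channel is again
symmetrized, with the involution `y_a^{i,j} ↦ ȳ_a^{j,i}`. -/
theorem stmt14 {Ya : Type*} [Fintype Ya] [DecidableEq Ya] {B : ℕ}
    (W : Ya → Ya × Bool × (Bool × Fin B) → Bool → Bool → ℝ)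
    (dB : Fin B → ℝ) (bar : Ya → Ya)
    (hW : IsJointChannel W) (hsucc : SuccessiveForm W)
    (hdB0 : ∀ i, 0 ≤ dB i) (hdBmono : Monotone dB)
    (hrep : DvalRepJoint W (vD dB))
    (hsym : SymmetrizedJoint W (vD dB) bar negD)
    (W2 : Bool × Fin B → Bool → Ya → Bool → ℝ)
    (hdec : DecouplingDecomp W W2)
    (hW2neg : ∀ r ub ya ua, W2 (negD r) (!ub) ya ua = W2 r ub ya ua)
    (hW2bar : ∀ r ub ya ua, W2 r ub (bar ya) (!ua) = W2 r ub ya ua) :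
    (∀ ya (i j : Fin B) ua r ub,
      margB (upgradeCouple W W2) ((ya, i, j), ua, r) ub =
        margB (upgradeCouple W W2) ((bar ya, j, i), !ua, r) ub ∧
      margB (upgradeCouple W W2) ((ya, i, j), ua, r) ub =
        margB (upgradeCouple W W2) ((ya, i, j), ua, negD r) (!ub) ∧
      margB (upgradeCouple W W2) ((ya, i, j), ua, r) ub =
        margB (upgradeCouple W W2) ((bar ya, j, i), !ua, negD r) (!ub)) ∧
    (∀ ya (i j : Fin B) ua,
      margA (upgradeCouple W W2) (ya, i, j) ua =
        margA (upgradeCouple W W2) (bar ya, j, i) (!ua)) := by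
  obtain ⟨-, -, -, -, hB⟩ := hsym
  have hbar : ∀ ya (i j : Fin B) ua r ub,
      margB (upgradeCouple W W2) ((ya, i, j), ua, r) ub =
        margB (upgradeCouple W W2) ((bar ya, j, i), !ua, r) ub := by
    intro ya i j ua r ub
    simp only [margB_upgradeCouple]
    rw [Sfac_bar_swap hW2bar, ← (hB ya ua r ub).1]
  refine ⟨fun ya i j ua r ub => ⟨hbar ya i j ua r ub, ?_, ?_⟩, fun ya i j ua => ?_⟩
  · simp only [margB_upgradeCouple]
    rw [Sfac_negD, ← (hB ya ua r ub).2.1]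
  · simp only [margB_upgradeCouple]
    rw [Sfac_negD, Sfac_bar_swap hW2bar, ← (hB ya ua r ub).2.2]
  · simp only [margA_upgradeCouple, hbar ya i j ua]
end
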